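/- Let K be the attractor of an IFS of similitudes on a complete metric space with similarity dimension α, endowed with its natural fractal structure. If the natural fractal structure is irreducible, then dim⁴(K) = dim³(K) = α. -/

import Mathlib

open scoped ENNReal

namespace IFSMoran

variable {X : Type*} [MetricSpace X]

/-- The map `f_i = f_{i1} o ... o f_{in}` associated to a word `i = i1...in`
(a list of indices). -/
def wMap {k : ℕ} (f : Fin k → X → X) : List (Fin k) → X → X
  | [] => id
  | i :: w => f i ∘ wMap f w

/-- The piece `A_i = f_i(K)` of the natural fractal structure. -/
def piece {k : ℕ} (f : Fin k → X → X) (K : Set X) (w : List (Fin k)) : Set X :=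
  wMap f w '' K

/-- The natural fractal structure (levels indexed by words) is irreducible:
no level admits a proper subcovering. -/
def Irred {k : ℕ} (f : Fin k → X → X) (K : Set X) : Prop :=
  ∀ w : List (Fin k),
    ¬ piece f K w ⊆ ⋃ v ∈ {v : List (Fin k) | v.length = w.length ∧ v ≠ w}, piece f K v

/-- `H³ₙˢ(K) = inf_{l ≥ n} ∑_{i ∈ Σˡ} diam (A_i) ^ s`. -/
noncomputable def H3n {k : ℕ} (f : Fin k → X → X) (K : Set X) (s : ℝ) (n : ℕ) : ℝ≥0∞ :=
  ⨅ (l : ℕ) (_ : n ≤ l),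
    ∑ w : Fin l → Fin k, EMetric.diam (piece f K (List.ofFn w)) ^ s

/-- `H³ˢ(K) = lim_n H³ₙˢ(K)`; the sequence is nondecreasing in `n`, so the limit
is the supremum. -/
noncomputable def H3 {k : ℕ} (f : Fin k → X → X) (K : Set X) (s : ℝ) : ℝ≥0∞ :=
  ⨆ n, H3n f K s n

/-- Fractal dimension III: `dim³(K) = inf {s ≥ 0 : H³ˢ(K) = 0}`. -/
noncomputable def dim3 {k : ℕ} (f : Fin k → X → X) (K : Set X) : ℝ :=
  sInf {s : ℝ | 0 ≤ s ∧ H3 f K s = 0}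

/-- `H⁴ₙˢ(K)`: infimum of `∑ diam (A_i) ^ s` over finite coverings of `K` by
pieces indexed by words of length `≥ n`. -/
noncomputable def H4n {k : ℕ} (f : Fin k → X → X) (K : Set X) (s : ℝ) (n : ℕ) : ℝ≥0∞ :=
  ⨅ (𝒜 : Finset (List (Fin k))) (_ : ∀ w ∈ 𝒜, n ≤ w.length)
      (_ : K ⊆ ⋃ w ∈ 𝒜, piece f K w),
    ∑ w ∈ 𝒜, EMetric.diam (piece f K w) ^ s

/-- `H⁴ˢ(K) = lim_n H⁴ₙˢ(K)`; the sequence is nondecreasing in `n`, so the limit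
is the supremum. -/
noncomputable def H4 {k : ℕ} (f : Fin k → X → X) (K : Set X) (s : ℝ) : ℝ≥0∞ :=
  ⨆ n, H4n f K s n

/-- Fractal dimension IV: `dim⁴(K) = inf {s ≥ 0 : H⁴ˢ(K) = 0}`. -/
noncomputable def dim4 {k : ℕ} (f : Fin k → X → X) (K : Set X) : ℝ :=
  sInf {s : ℝ | 0 ≤ s ∧ H4 f K s = 0}

/-- Interior of `A` relative to `K` (as a subset of the ambient space `X`). -/
def intK (K A : Set X) : Set X := K \ closure (K \ A)

/-- The level separation property: interiors (in `K`) of two pieces indexed by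
distinct words of the same length are disjoint (LSP1), and every piece has
nonempty interior in `K` (LSP2). -/
def LSP {k : ℕ} (f : Fin k → X → X) (K : Set X) : Prop :=
  (∀ v w : List (Fin k), v.length = w.length → v ≠ w →
      intK K (piece f K v) ∩ intK K (piece f K w) = ∅) ∧
  ∀ w : List (Fin k), (intK K (piece f K w)).Nonempty

/-- The natural fractal structure is a tiling: pieces indexed by distinct words
of the same length have disjoint interiors in `K`, and every piece is regularly
closed in `K`, i.e. `cl_K (int_K (A_i)) = A_i`. -/
def IsTiling {k : ℕ} (f : Fin k → X → X) (K : Set X) : Prop :=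
  (∀ v w : List (Fin k), v.length = w.length → v ≠ w →
      intK K (piece f K v) ∩ intK K (piece f K w) = ∅) ∧
  ∀ w : List (Fin k), closure (intK K (piece f K w)) ∩ K = piece f K w


/-- The ratio of the similitude associated to a word. -/
def wRatio {k : ℕ} (c : Fin k → ℝ) (w : List (Fin k)) : ℝ := (w.map c).prod

lemma wRatio_pos {k : ℕ} {c : Fin k → ℝ} (hc : ∀ i, 0 < c i) (w : List (Fin k)) :
    0 < wRatio c w :=
  List.prod_pos (by simpa using fun i _ => hc i)

lemma wRatio_le_one {k : ℕ} {c : Fin k → ℝ} (hc : ∀ i, c i ∈ Set.Ioo (0 : ℝ) 1)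
    (w : List (Fin k)) : wRatio c w ≤ 1 := by
  induction w with
  | nil => simp [wRatio]
  | cons i w ih =>
    have h : wRatio c (i :: w) = c i * wRatio c w := by simp [wRatio]
    rw [h]
    exact mul_le_one₀ (hc i).2.le (wRatio_pos (fun i => (hc i).1) w).le ih

lemma wRatio_rpow {k : ℕ} {c : Fin k → ℝ} (hc : ∀ i, 0 < c i) (s : ℝ) (w : List (Fin k)) :
    wRatio c w ^ s = wRatio (fun i => c i ^ s) w := by
  induction w with
  | nil => simp [wRatio]
  | cons i w ih =>
    simp only [wRatio, List.map_cons, List.prod_cons] at ih ⊢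
    rw [Real.mul_rpow (hc i).le (List.prod_nonneg (by simpa using fun j _ => (hc j).le)), ih]

lemma sum_wRatio_ofFn {k : ℕ} (a : Fin k → ℝ) (l : ℕ) :
    ∑ w : Fin l → Fin k, wRatio a (List.ofFn w) = (∑ i, a i) ^ l := by
  simp [wRatio, Fintype.sum_pow, List.map_ofFn, List.prod_ofFn]

/-- A Kraft-type inequality: if every word of length `m` has a prefix in `𝒜`, then the total
weight of `𝒜` is at least one. -/
lemma one_le_sum_wRatio {k : ℕ} {a : Fin k → ℝ} (ha : ∀ i, 0 < a i) (hsum : ∑ i, a i = 1)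
    (m : ℕ) (𝒜 : Finset (List (Fin k)))
    (h : ∀ u : List (Fin k), u.length = m → ∃ w ∈ 𝒜, w <+: u) :
    1 ≤ ∑ w ∈ 𝒜, wRatio a w := by
  have hnil : ∀ ℬ : Finset (List (Fin k)), [] ∈ ℬ → 1 ≤ ∑ w ∈ ℬ, wRatio a w := fun ℬ hℬ => by
    simpa [wRatio] using
      Finset.single_le_sum (f := wRatio a) (fun w _ => (wRatio_pos ha w).le) hℬ
  induction m generalizing 𝒜 with
  | zero =>
    obtain ⟨w, hw, hp⟩ := h [] rfl
    rw [List.prefix_nil.1 hp] at hw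
    exact hnil 𝒜 hw
  | succ m ih =>
    by_cases h0 : [] ∈ 𝒜
    · exact hnil 𝒜 h0
    let ℬ : Fin k → Finset (List (Fin k)) := fun i =>
      𝒜.preimage (List.cons i) (List.cons_injective.injOn)
    have hℬ : ∀ i, 1 ≤ ∑ w ∈ ℬ i, wRatio a w := fun i => by
      refine ih _ fun u hu => ?_
      obtain ⟨w, hw, hp⟩ := h (i :: u) (by simp [hu])
      rcases List.prefix_cons_iff.1 hp with rfl | ⟨t, rfl, ht⟩
      · exact absurd hw h0
      · exact ⟨t, by simpa [ℬ] using hw, ht⟩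
    calc (1 : ℝ) = ∑ i, a i * 1 := by simp [hsum]
      _ ≤ ∑ i, a i * ∑ w ∈ ℬ i, wRatio a w :=
        Finset.sum_le_sum fun i _ => mul_le_mul_of_nonneg_left (hℬ i) (ha i).le
      _ = ∑ p ∈ Finset.univ.sigma ℬ, wRatio a (p.1 :: p.2) := by
        simp [Finset.sum_sigma, Finset.mul_sum, wRatio]
      _ = ∑ w ∈ (Finset.univ.sigma ℬ).image (fun p => p.1 :: p.2), wRatio a w := by
        rw [Finset.sum_image]
        rintro ⟨i, u⟩ - ⟨j, v⟩ - huv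
        simpa using huv
      _ ≤ ∑ w ∈ 𝒜, wRatio a w := by
        refine Finset.sum_le_sum_of_subset_of_nonneg ?_ fun w _ _ => (wRatio_pos ha w).le
        intro w hw
        obtain ⟨⟨i, u⟩, hu, rfl⟩ := Finset.mem_image.1 hw
        simpa [ℬ] using hu

lemma edist_wMap {k : ℕ} {f : Fin k → X → X} {c : Fin k → ℝ} (hc : ∀ i, 0 < c i)
    (hf : ∀ i x y, dist (f i x) (f i y) = c i * dist x y) (w : List (Fin k)) (x y : X) :
    edist (wMap f w x) (wMap f w y) = ENNReal.ofReal (wRatio c w) * edist x y := by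
  induction w with
  | nil => simp [wMap, wRatio]
  | cons i w ih =>
    have hi : ∀ x y, edist (f i x) (f i y) = ENNReal.ofReal (c i) * edist x y := fun x y => by
      rw [edist_dist, hf, ENNReal.ofReal_mul (hc i).le, ← edist_dist]
    have h : wRatio c (i :: w) = c i * wRatio c w := by simp [wRatio]
    rw [h, ENNReal.ofReal_mul (hc i).le, mul_assoc, ← ih, ← hi]
    rfl

lemma ediam_piece {k : ℕ} {f : Fin k → X → X} {c : Fin k → ℝ} (hc : ∀ i, 0 < c i)
    (hf : ∀ i x y, dist (f i x) (f i y) = c i * dist x y) (K : Set X) (w : List (Fin k)) :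
    Metric.ediam (piece f K w) = ENNReal.ofReal (wRatio c w) * Metric.ediam K := by
  simp only [Metric.ediam, piece, iSup_image, edist_wMap hc hf, ENNReal.mul_iSup]

lemma ediam_piece_rpow {k : ℕ} {f : Fin k → X → X} {c : Fin k → ℝ} (hc : ∀ i, 0 < c i)
    (hf : ∀ i x y, dist (f i x) (f i y) = c i * dist x y) (K : Set X) {s : ℝ} (hs : 0 ≤ s)
    (w : List (Fin k)) :
    Metric.ediam (piece f K w) ^ s = ENNReal.ofReal (wRatio c w ^ s) * Metric.ediam K ^ s := by
  rw [ediam_piece hc hf, ENNReal.mul_rpow_of_nonneg _ _ hs,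
    ENNReal.ofReal_rpow_of_pos (wRatio_pos hc w)]

lemma piece_append {k : ℕ} (f : Fin k → X → X) (K : Set X) (u v : List (Fin k)) :
    piece f K (u ++ v) = wMap f u '' piece f K v := by
  induction u with
  | nil => simp [wMap]
  | cons i u ih =>
    have h : piece f K (i :: u ++ v) = f i '' piece f K (u ++ v) :=
      Set.image_comp (f i) (wMap f (u ++ v)) K
    rw [h, ih, wMap, Set.image_comp]

lemma exists_mem_piece {k : ℕ} {f : Fin k → X → X} {K : Set X} (hK : K = ⋃ i, f i '' K)
    (n : ℕ) {x : X} (hx : x ∈ K) : ∃ v : List (Fin k), v.length = n ∧ x ∈ piece f K v := by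
  induction n generalizing x with
  | zero => exact ⟨[], rfl, by simpa [piece, wMap] using hx⟩
  | succ n ih =>
    rw [hK] at hx
    obtain ⟨i, y, hy, rfl⟩ := Set.mem_iUnion.1 hx
    obtain ⟨v, hv, z, hz, rfl⟩ := ih hy
    exact ⟨i :: v, by simp [hv], z, hz, rfl⟩

lemma piece_subset {k : ℕ} {f : Fin k → X → X} {K : Set X} (hK : K = ⋃ i, f i '' K)
    (w : List (Fin k)) : piece f K w ⊆ K := by
  induction w with
  | nil => simp [piece, wMap]
  | cons i w ih =>
    rw [piece, wMap, Set.image_comp]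
    exact (Set.image_mono ih).trans ((Set.subset_iUnion (fun i => f i '' K) i).trans hK.ge)

lemma exists_prefix_of_cover {k : ℕ} {f : Fin k → X → X} {K : Set X}
    (hK : K = ⋃ i, f i '' K) (hirr : Irred f K) {𝒜 : Finset (List (Fin k))}
    (hcov : K ⊆ ⋃ w ∈ 𝒜, piece f K w) {u : List (Fin k)}
    (hlen : ∀ w ∈ 𝒜, w.length ≤ u.length) : ∃ w ∈ 𝒜, w <+: u := by
  by_contra! hu
  refine hirr u fun x hx => ?_
  obtain ⟨w, hw, y, hy, rfl⟩ := Set.mem_iUnion₂.1 (hcov (piece_subset hK u hx))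
  obtain ⟨v, hv, hyv⟩ := exists_mem_piece hK (u.length - w.length) hy
  refine Set.mem_iUnion₂.2 ⟨w ++ v, ⟨?_, ?_⟩, ?_⟩
  · have := hlen w hw
    simp [hv, this]
  · rintro rfl
    exact hu w hw (List.prefix_append w v)
  · rw [piece_append]
    exact ⟨y, hyv, rfl⟩

lemma Irred.ediam_pos {k : ℕ} {f : Fin k → X → X} {K : Set X} (hk : 2 ≤ k)
    (hKne : K.Nonempty) (hK : K = ⋃ i, f i '' K) (hirr : Irred f K) : 0 < Metric.ediam K := by
  rw [Metric.ediam_pos_iff]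
  by_contra hsub
  rw [Set.not_nontrivial_iff] at hsub
  let i : Fin k := ⟨0, by omega⟩
  let j : Fin k := ⟨1, by omega⟩
  refine hirr [i] fun x hx => Set.mem_iUnion₂.2 ⟨[j], ⟨rfl, by simp [i, j]⟩, ?_⟩
  obtain ⟨y, hy⟩ := hKne.image (wMap f [j])
  rwa [hsub (piece_subset hK _ hx) (piece_subset hK [j] hy)]

lemma H4_le_H3 {k : ℕ} {f : Fin k → X → X} {K : Set X} (hK : K = ⋃ i, f i '' K) (s : ℝ) :
    H4 f K s ≤ H3 f K s := by
  refine iSup_mono fun n => le_iInf₂ fun l hl => ?_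
  refine (iInf_le_of_le (Finset.univ.image (List.ofFn (n := l))) <|
    iInf₂_le_of_le ?_ ?_ (Finset.sum_image List.ofFn_injective.injOn).le)
  · simpa using fun _ => hl
  · intro x hx
    obtain ⟨v, rfl, hv⟩ := exists_mem_piece hK l hx
    exact Set.mem_iUnion₂.2 ⟨v, Finset.mem_image.2 ⟨v.get, by simp, List.ofFn_get v⟩, hv⟩

lemma H3_eq_zero {k : ℕ} {f : Fin k → X → X} {c : Fin k → ℝ} (hc : ∀ i, 0 < c i)
    (hf : ∀ i x y, dist (f i x) (f i y) = c i * dist x y) {K : Set X}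
    (hKd : Metric.ediam K ≠ ⊤) {s : ℝ} (hs : 0 ≤ s) (hsum : ∑ i, c i ^ s < 1) :
    H3 f K s = 0 := by
  have hr : 0 ≤ ∑ i, c i ^ s := Finset.sum_nonneg fun i _ => Real.rpow_nonneg (hc i).le s
  have hlevel : ∀ l, ∑ w : Fin l → Fin k, Metric.ediam (piece f K (List.ofFn w)) ^ s =
      ENNReal.ofReal (∑ i, c i ^ s) ^ l * Metric.ediam K ^ s := fun l => by
    simp_rw [ediam_piece_rpow hc hf K hs]
    rw [← Finset.sum_mul, ← ENNReal.ofReal_sum_of_nonneg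
      fun w _ => Real.rpow_nonneg (wRatio_pos hc _).le s]
    simp_rw [wRatio_rpow hc]
    rw [sum_wRatio_ofFn, ENNReal.ofReal_pow hr]
  have hlim : Filter.Tendsto
      (fun l : ℕ => ENNReal.ofReal (∑ i, c i ^ s) ^ l * Metric.ediam K ^ s)
      Filter.atTop (nhds 0) := by
    have h := ENNReal.Tendsto.mul_const
      (ENNReal.tendsto_pow_atTop_nhds_zero_of_lt_one (ENNReal.ofReal_lt_one.2 hsum))
      (Or.inr (ENNReal.rpow_ne_top_of_nonneg hs hKd))
    simpa using h
  refine le_antisymm (iSup_le fun n => ?_) bot_le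
  refine ge_of_tendsto hlim (Filter.eventually_atTop.2 ⟨n, fun l hl => ?_⟩)
  exact (iInf₂_le l hl).trans (hlevel l).le

lemma ediam_rpow_le_H4 {k : ℕ} {f : Fin k → X → X} {c : Fin k → ℝ}
    (hc : ∀ i, c i ∈ Set.Ioo (0 : ℝ) 1)
    (hf : ∀ i x y, dist (f i x) (f i y) = c i * dist x y) {K : Set X}
    (hK : K = ⋃ i, f i '' K) {α : ℝ} (hαsum : ∑ i, c i ^ α = 1) (hirr : Irred f K)
    {s : ℝ} (hs : 0 ≤ s) (hsα : s ≤ α) : Metric.ediam K ^ s ≤ H4 f K s := by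
  have hc0 : ∀ i, 0 < c i := fun i => (hc i).1
  refine le_iSup_of_le 0 (le_iInf fun 𝒜 => le_iInf₂ fun _ hcov => ?_)
  have hpre : ∀ u : List (Fin k), u.length = 𝒜.sup List.length → ∃ w ∈ 𝒜, w <+: u :=
    fun u hu => exists_prefix_of_cover hK hirr hcov fun w hw => hu ▸ Finset.le_sup hw
  have hone : 1 ≤ ∑ w ∈ 𝒜, wRatio c w ^ s :=
    calc 1 ≤ ∑ w ∈ 𝒜, wRatio (fun i => c i ^ α) w :=
          one_le_sum_wRatio (fun i => Real.rpow_pos_of_pos (hc0 i) α) hαsum _ 𝒜 hpre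
      _ = ∑ w ∈ 𝒜, wRatio c w ^ α := by simp_rw [wRatio_rpow hc0]
      _ ≤ ∑ w ∈ 𝒜, wRatio c w ^ s := Finset.sum_le_sum fun w _ =>
          Real.rpow_le_rpow_of_exponent_ge (wRatio_pos hc0 w) (wRatio_le_one hc w) hsα
  have hsum : ∑ w ∈ 𝒜, Metric.ediam (piece f K w) ^ s =
      ENNReal.ofReal (∑ w ∈ 𝒜, wRatio c w ^ s) * Metric.ediam K ^ s := by
    simp_rw [ediam_piece_rpow hc0 hf K hs]
    rw [← Finset.sum_mul, ENNReal.ofReal_sum_of_nonneg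
      fun w _ => Real.rpow_nonneg (wRatio_pos hc0 _).le s]
  exact (le_mul_of_one_le_left bot_le (ENNReal.one_le_ofReal.2 hone)).trans hsum.ge

theorem stmt_5 {X : Type*} [MetricSpace X] [CompleteSpace X]
    {k : ℕ} (hk : 2 ≤ k) (f : Fin k → X → X) (c : Fin k → ℝ)
    (hc : ∀ i, c i ∈ Set.Ioo (0 : ℝ) 1)
    (hf : ∀ i x y, dist (f i x) (f i y) = c i * dist x y)
    (K : Set X) (hKne : K.Nonempty) (hKcp : IsCompact K)
    (hK : K = ⋃ i, f i '' K)
    (α : ℝ) (hα : 0 < α) (hαsum : ∑ i, c i ^ α = 1)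
    (hirr : Irred f K) :
    dim4 f K = α ∧ dim3 f K = α := by
  have hc0 : ∀ i, 0 < c i := fun i => (hc i).1
  have hKd : Metric.ediam K ≠ ⊤ := hKcp.isBounded.ediam_ne_top
  have hzero : ∀ s, α < s → H3 f K s = 0 := fun s hs => by
    refine H3_eq_zero hc0 hf hKd (hα.trans hs).le (hαsum ▸ Finset.sum_lt_sum_of_nonempty ?_ ?_)
    · exact ⟨⟨0, by omega⟩, Finset.mem_univ _⟩
    · exact fun i _ => Real.rpow_lt_rpow_of_exponent_gt (hc0 i) (hc i).2 hs
  have hpos : ∀ s, 0 ≤ s → s ≤ α → 0 < H4 f K s := fun s hs hsα =>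
    (ENNReal.rpow_pos (hirr.ediam_pos hk hKne hK) hKd).trans_le
      (ediam_rpow_le_H4 hc hf hK hαsum hirr hs hsα)
  have h4 : {s : ℝ | 0 ≤ s ∧ H4 f K s = 0} = Set.Ioi α := by
    ext s
    refine ⟨fun h => Set.mem_Ioi.2 <| lt_of_not_ge fun hs => (hpos s h.1 hs).ne' h.2, fun hs => ?_⟩
    exact ⟨(hα.trans hs).le, le_antisymm ((H4_le_H3 hK s).trans (hzero s hs).le) bot_le⟩
  have h3 : {s : ℝ | 0 ≤ s ∧ H3 f K s = 0} = Set.Ioi α := by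
    ext s
    refine ⟨fun h => Set.mem_Ioi.2 <| lt_of_not_ge fun hs => ?_, fun hs => ⟨(hα.trans hs).le, hzero s hs⟩⟩
    exact ((hpos s h.1 hs).trans_le (H4_le_H3 hK s)).ne' h.2
  exact ⟨by rw [dim4, h4, csInf_Ioi], by rw [dim3, h3, csInf_Ioi]⟩

end IFSMoran
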